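/- arXiv:2106.03509 — 3 statements merged into one kernel-verified Lean document; each statement's English description precedes it below -/
import Mathlib

section
/- For every integer n ≥ 10 and every choice of indices {j,k,l} = {1,2,3}, one has |(r_l − r_k)/(r_l − r_j)| ≤ 4. -/
open Real

/-- The golden ratio α = (1+√5)/2. -/
noncomputable def alpha : ℝ := (1 + Real.sqrt 5) / 2

/-- The Lucas sequence: L 0 = 2, L 1 = 1, L (n+2) = L (n+1) + L n. -/
def lucas : ℕ → ℤ
  | 0 => 2
  | 1 => 1
  | n + 2 => lucas (n + 1) + lucas n

/-- The cubic polynomial f_n(X) = (X − F_n)(X − L_n)X − 1. -/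
noncomputable def fpoly (n : ℕ) (X : ℝ) : ℝ :=
  (X - (Nat.fib n : ℝ)) * (X - (lucas n : ℝ)) * X - 1

/-- Lucas numbers in terms of Fibonacci numbers. -/
theorem lucas_succ_eq_fib (n : ℕ) :
    lucas (n + 1) = Nat.fib (n + 1) + 2 * Nat.fib n := by
  induction n using Nat.twoStepInduction with
  | zero => simp [lucas]
  | one => simp [lucas]
  | more n ih₀ ih₁ =>
    rw [lucas, ih₀, ih₁, Nat.fib_add_two (n := n + 1), Nat.fib_add_two (n := n)]
    push_cast
    ring

theorem two_mul_fib_le_lucas {n : ℕ} (hn : 2 ≤ n) : 2 * (Nat.fib n : ℤ) ≤ lucas n := by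
  obtain ⟨m, rfl⟩ := Nat.exists_eq_add_of_le' hn
  have := Nat.fib_le_fib_succ (n := m)
  rw [lucas_succ_eq_fib (m + 1), Nat.fib_add_two]
  omega

theorem lucas_le_three_mul_fib {n : ℕ} (hn : 1 ≤ n) : lucas n ≤ 3 * (Nat.fib n : ℤ) := by
  obtain ⟨m, rfl⟩ := Nat.exists_eq_add_of_le' hn
  have := Nat.fib_le_fib_succ (n := m)
  rw [lucas_succ_eq_fib]
  omega

/-- A solution of `(x - p) (x - q) x = 1` lies close to one of `0`, `p`, `q`. -/
theorem root_location {p q x : ℝ} (hp : 2 < p) (hpq : p + 1 ≤ q)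
    (hx : (x - p) * (x - q) * x - 1 = 0) :
    (0 < x ∧ x < 1) ∨ (p - 1 < x ∧ x < p) ∨ (q < x ∧ x < q + 1) := by
  have hpos : 0 < x := by
    by_contra! h
    nlinarith [mul_nonneg (sub_nonneg.2 (show x ≤ p by linarith))
      (sub_nonneg.2 (show x ≤ q by linarith))]
  rcases lt_or_ge x 1 with h1 | h1
  · exact .inl ⟨hpos, h1⟩
  rcases lt_or_ge x p with h2 | h2
  · refine .inr (.inl ⟨?_, h2⟩)
    by_contra! h
    have h3 : 2 ≤ (p - x) * (q - x) := by nlinarith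
    nlinarith
  · have h3 : q < x := by
      by_contra! h
      nlinarith [mul_nonneg (sub_nonneg.2 h2) (sub_nonneg.2 h)]
    refine .inr (.inr ⟨h3, ?_⟩)
    by_contra! h
    have h4 : 1 ≤ (x - p) * (x - q) := by nlinarith
    nlinarith

/-- The sum of three distinct solutions of `(x - p) (x - q) x = 1`. -/
theorem root_sum {p q a b c : ℝ} (hab : a ≠ b) (hbc : b ≠ c) (hac : a ≠ c)
    (ha : (a - p) * (a - q) * a - 1 = 0) (hb : (b - p) * (b - q) * b - 1 = 0)
    (hc : (c - p) * (c - q) * c - 1 = 0) : a + b + c = p + q := by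
  have h1 : a ^ 2 + a * b + b ^ 2 - (p + q) * (a + b) + p * q = 0 :=
    mul_left_cancel₀ (sub_ne_zero.2 hab) (by linear_combination ha - hb)
  have h2 : c ^ 2 + c * b + b ^ 2 - (p + q) * (c + b) + p * q = 0 :=
    mul_left_cancel₀ (sub_ne_zero.2 hbc) (by linear_combination hb - hc)
  exact mul_left_cancel₀ (sub_ne_zero.2 hac) (by linear_combination h1 - h2)

/-- The gaps between the three solutions of `(x - p) (x - q) x = 1` are comparable. -/
theorem root_gaps {p q a b c : ℝ} (hp : 9 ≤ p) (hpq : 2 * p ≤ q) (hqp : q ≤ 3 * p)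
    (hab : a < b) (hbc : b < c)
    (ha : (a - p) * (a - q) * a - 1 = 0) (hb : (b - p) * (b - q) * b - 1 = 0)
    (hc : (c - p) * (c - q) * c - 1 = 0) :
    c - a ≤ 4 * (b - a) ∧ c - a ≤ 4 * (c - b) := by
  have hsum := root_sum hab.ne hbc.ne (hab.trans hbc).ne ha hb hc
  have hloc {x : ℝ} := root_location (x := x) (show 2 < p by linarith) (show p + 1 ≤ q by linarith)
  rcases hloc ha with ⟨_, _⟩ | ⟨_, _⟩ | ⟨_, _⟩ <;>
  rcases hloc hb with ⟨_, _⟩ | ⟨_, _⟩ | ⟨_, _⟩ <;>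
  rcases hloc hc with ⟨_, _⟩ | ⟨_, _⟩ | ⟨_, _⟩ <;>
  constructor <;> linarith

theorem root_ratio_bound (n : ℕ) (hn : 10 ≤ n) (r : Fin 3 → ℝ)
    (hroot : ∀ i, fpoly n (r i) = 0)
    (hord : r 2 < r 0 ∧ r 0 < r 1)
    (j k l : Fin 3) (hjk : j ≠ k) (hjl : j ≠ l) (hkl : k ≠ l) :
    |(r l - r k) / (r l - r j)| ≤ 4 := by
  obtain ⟨h20, h01⟩ := hord
  have hp : (9 : ℝ) ≤ Nat.fib n := by
    have h : Nat.fib 10 ≤ Nat.fib n := Nat.fib_mono hn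
    have h10 : Nat.fib 10 = 55 := by norm_num
    exact_mod_cast (show 9 ≤ Nat.fib n by omega)
  have hpq : 2 * (Nat.fib n : ℝ) ≤ lucas n := by
    exact_mod_cast two_mul_fib_le_lucas (show 2 ≤ n by omega)
  have hqp : (lucas n : ℝ) ≤ 3 * Nat.fib n := by
    exact_mod_cast lucas_le_three_mul_fib (show 1 ≤ n by omega)
  obtain ⟨h₁, h₂⟩ := root_gaps hp hpq hqp h20 h01 (hroot 2) (hroot 0) (hroot 1)
  have hne : r l - r j ≠ 0 := by
    fin_cases j <;> fin_cases l <;> simp_all [sub_eq_zero] <;> intro h <;> linarith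
  rw [abs_div, div_le_iff₀ (abs_pos.2 hne)]
  have key : |r l - r k| ≤ r 1 - r 2 ∧ r 1 - r 2 ≤ 4 * |r l - r j| := by
    constructor
    · fin_cases k <;> fin_cases l <;>
        simp only [Fin.reduceFinMk, Fin.zero_eta, Fin.mk_one, Fin.isValue, abs_le] <;>
        constructor <;> linarith
    · fin_cases j <;> fin_cases l <;> first
        | exact absurd rfl hjl
        | (simp only [Fin.reduceFinMk, Fin.zero_eta, Fin.mk_one, Fin.isValue]
           first
             | rw [abs_of_pos (by linarith)]; linarith
             | rw [abs_of_neg (by linarith)]; linarith)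
  exact key.1.trans key.2
end

section
/- For every integer n ≥ 10 and every pair of distinct indices i, i' ∈ {1,2,3}, the determinant D := log|r_i|·log|r_{i'} − F_n| − log|r_i − F_n|·log|r_{i'}| satisfies 2·(log α)²·n² ≤ |D| ≤ 2·n². -/
open Real

theorem alpha_sq : alpha ^ 2 = alpha + 1 := by
  have h := Real.sq_sqrt (show (0 : ℝ) ≤ 5 by norm_num)
  unfold alpha
  linarith

theorem alpha_gt : 1.6 < alpha := by
  have h : (2.2 : ℝ) < Real.sqrt 5 := Real.lt_sqrt_of_sq_lt (by norm_num)
  unfold alpha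
  linarith

theorem alpha_lt : alpha < 1.62 := by
  have h : Real.sqrt 5 < 2.24 := (Real.sqrt_lt' (by norm_num)).2 (by norm_num)
  unfold alpha
  linarith

theorem alpha_pow_add_two (n : ℕ) : alpha ^ (n + 2) = alpha ^ (n + 1) + alpha ^ n := by
  rw [pow_add, alpha_sq]
  ring

theorem fib_lucas_bounds (k : ℕ) :
    alpha ^ (k + 8) ≤ (Nat.fib (k + 10) : ℝ) - 1 ∧
      alpha ^ (k + 9) ≤ (lucas (k + 10) : ℝ) - 1 ∧
      alpha ^ (k + 8) ≤ (lucas (k + 10) : ℝ) - (Nat.fib (k + 10) : ℝ) ∧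
      (lucas (k + 10) : ℝ) ≤ 2 ^ (k + 10) := by
  have hα := alpha_lt
  have h8 : alpha ^ 8 = 21 * alpha + 13 := by
    linear_combination (alpha ^ 6 + alpha ^ 5 + 2 * alpha ^ 4 + 3 * alpha ^ 3 + 5 * alpha ^ 2
      + 8 * alpha + 13) * alpha_sq
  have h9 : alpha ^ 9 = 34 * alpha + 21 := by
    linear_combination alpha * h8 + 21 * alpha_sq
  have h10 : alpha ^ 10 = 55 * alpha + 34 := by
    linear_combination alpha * h9 + 34 * alpha_sq
  induction k using Nat.twoStepInduction with
  | zero =>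
    have hf : Nat.fib 10 = 55 := by norm_num
    have hl : lucas 10 = 123 := by simp [lucas]
    simp only [zero_add, hf, hl, h8, h9]
    norm_num
    constructor <;> [skip; constructor] <;> linarith
  | one =>
    have hf : Nat.fib 11 = 89 := by norm_num
    have hl : lucas 11 = 199 := by simp [lucas]
    simp only [Nat.reduceAdd, hf, hl, h9, h10]
    norm_num
    constructor <;> [skip; constructor] <;> linarith
  | more k ih₀ ih₁ =>
    obtain ⟨a₀, b₀, c₀, d₀⟩ := ih₀
    obtain ⟨a₁, b₁, c₁, d₁⟩ := ih₁
    have hf : (Nat.fib (k + 2 + 10) : ℝ) = Nat.fib (k + 10) + Nat.fib (k + 1 + 10) := by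
      exact_mod_cast Nat.fib_add_two (n := k + 10)
    have hl : (lucas (k + 2 + 10) : ℝ) = lucas (k + 1 + 10) + lucas (k + 10) := by
      have h : lucas (k + 2 + 10) = lucas (k + 1 + 10) + lucas (k + 10) := rfl
      exact_mod_cast h
    have e8 : alpha ^ (k + 2 + 8) = alpha ^ (k + 1 + 8) + alpha ^ (k + 8) :=
      alpha_pow_add_two (k + 8)
    have e9 : alpha ^ (k + 2 + 9) = alpha ^ (k + 1 + 9) + alpha ^ (k + 9) :=
      alpha_pow_add_two (k + 9)
    have e2 : (2 : ℝ) ^ (k + 2 + 10) = 2 * 2 ^ (k + 1 + 10) := by ring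
    have e2' : (2 : ℝ) ^ (k + 1 + 10) = 2 * 2 ^ (k + 10) := by ring
    have hpos : (0 : ℝ) < 2 ^ (k + 10) := by positivity
    rw [hf, hl, e8, e9]
    refine ⟨?_, ?_, ?_, ?_⟩ <;> linarith

/-- If `(t - A) * (t - B) * t - 1` has three distinct roots `x, y, z`, it factors completely. -/
theorem cubic_eq_prod_of_roots {A B x y z : ℝ}
    (hx : (x - A) * (x - B) * x - 1 = 0) (hy : (y - A) * (y - B) * y - 1 = 0)
    (hz : (z - A) * (z - B) * z - 1 = 0) (hxy : x ≠ y) (hxz : x ≠ z) (hyz : y ≠ z) (t : ℝ) :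
    (t - A) * (t - B) * t - 1 = (t - x) * (t - y) * (t - z) := by
  have h₁ : x ^ 2 + x * y + y ^ 2 - (A + B) * (x + y) + A * B = 0 := by
    apply mul_left_cancel₀ (sub_ne_zero.2 hxy)
    linear_combination hx - hy
  have h₂ : x ^ 2 + x * z + z ^ 2 - (A + B) * (x + z) + A * B = 0 := by
    apply mul_left_cancel₀ (sub_ne_zero.2 hxz)
    linear_combination hx - hz
  have h₃ : x + y + z - (A + B) = 0 := by
    apply mul_left_cancel₀ (sub_ne_zero.2 hyz)
    linear_combination h₁ - h₂
  linear_combination hx + (t - x) * h₁ + (t - x) * (t - y) * h₃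

theorem root_location_s11 {A B x y z : ℝ} (hA : 4 ≤ A) (hAB : A + 4 ≤ B)
    (hx : (x - A) * (x - B) * x - 1 = 0) (hy : (y - A) * (y - B) * y - 1 = 0)
    (hz : (z - A) * (z - B) * z - 1 = 0) (hzx : z < x) (hxy : x < y) :
    0 < z ∧ z < 1 ∧ A - 1 < x ∧ x < A ∧ B < y := by
  have hfac := cubic_eq_prod_of_roots hx hy hz hxy.ne hzx.ne' (hzx.trans hxy).ne'
  have hpos : ∀ t, (t - A) * (t - B) * t - 1 = 0 → 0 < t ∧ (t < A ∨ B < t) := by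
    intro t ht
    have h0 : 0 < t := by
      by_contra! h
      nlinarith [mul_nonneg (show 0 ≤ A - t by linarith) (show 0 ≤ B - t by linarith)]
    refine ⟨h0, ?_⟩
    by_contra! h
    nlinarith [mul_nonneg (mul_nonneg (sub_nonneg.2 h.1) (sub_nonneg.2 h.2)) h0.le]
  have hsmall : ∀ t, (t - A) * (t - B) * t - 1 = 0 → t < A → t < 1 ∨ A - 1 < t := by
    intro t ht hlt
    by_contra! h
    have h₁ : 3 ≤ (A - t) * t := by nlinarith [mul_nonneg (sub_nonneg.2 h.1) (sub_nonneg.2 h.2)]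
    nlinarith [mul_nonneg (sub_nonneg.2 h₁) (show 0 ≤ B - t by linarith)]
  have hsum : x + y + z = A + B := by
    linear_combination (hfac 1 + hfac (-1) - 2 * hfac 0) / 2
  obtain ⟨z0, -⟩ := hpos z hz
  obtain ⟨-, hx'⟩ := hpos x hx
  obtain ⟨-, hy'⟩ := hpos y hy
  have hxA : x < A := by
    rcases hx' with h | h
    · exact h
    · linarith
  have hBy : B < y := by
    rcases hy' with h | h
    · have := mul_pos (mul_pos (show 0 < B - x by linarith) (show 0 < B - y by linarith))
        (show 0 < B - z by linarith)
      linarith [hfac B]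
    · exact h
  have hyB : y < B + 1 := by
    by_contra! h
    have h₁ : 4 ≤ (y - A) * (y - B) := by nlinarith
    nlinarith
  have hzs := hsmall z hz (hzx.trans hxA)
  have hxs := hsmall x hx hxA
  refine ⟨z0, ?_, ?_, hxA, hBy⟩
  · rcases hzs with h | h <;> linarith
  · rcases hxs with h | h <;> linarith

theorem regulator_form_bounds {N l s a b p q : ℝ} (hN : 10 ≤ N) (hl : 0 ≤ l) (hs : s ≤ 0.7 * N)
    (ha : (N - 2) * l ≤ a) (hb : (N - 2) * l ≤ b) (hp : (N - 1) * l ≤ p) (hq : (N - 2) * l ≤ q)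
    (ha' : a ≤ s) (hb' : b ≤ s) (hp' : p ≤ s) (hq' : q ≤ s) :
    2 * l ^ 2 * N ^ 2 ≤ (b + p) * (a + q) - a * b ∧ (b + p) * (a + q) - a * b ≤ 2 * N ^ 2 := by
  have h2 : 0 ≤ (N - 2) * l := mul_nonneg (by linarith) hl
  have h1 : 0 ≤ (N - 1) * l := mul_nonneg (by linarith) hl
  constructor
  · have e₁ := mul_le_mul hb hq h2 (h2.trans hb)
    have e₂ := mul_le_mul hp ha h2 (h1.trans hp)
    have e₃ := mul_le_mul hp hq h2 (h1.trans hp)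
    have : 0 ≤ (N ^ 2 - 10 * N + 8) * l ^ 2 := mul_nonneg (by nlinarith) (sq_nonneg l)
    nlinarith
  · have hs0 : 0 ≤ s := h2.trans (ha.trans ha')
    have e₁ := mul_le_mul hb' hq' (h2.trans hq) hs0
    have e₂ := mul_le_mul hp' ha' (h2.trans ha) hs0
    have e₃ := mul_le_mul hp' hq' (h2.trans hq) hs0
    nlinarith [mul_self_le_mul_self hs0 hs]

theorem regulator_bounds (n : ℕ) (hn : 10 ≤ n) (r : Fin 3 → ℝ)
    (hroot : ∀ i, fpoly n (r i) = 0)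
    (hord : r 2 < r 0 ∧ r 0 < r 1)
    (i i' : Fin 3) (hii' : i ≠ i') :
    2 * Real.log alpha ^ 2 * (n : ℝ) ^ 2 ≤
      |Real.log |r i| * Real.log |r i' - (Nat.fib n : ℝ)| -
        Real.log |r i - (Nat.fib n : ℝ)| * Real.log (|r i'|)| ∧
    |Real.log |r i| * Real.log |r i' - (Nat.fib n : ℝ)| -
        Real.log |r i - (Nat.fib n : ℝ)| * Real.log (|r i'|)| ≤ 2 * (n : ℝ) ^ 2 := by
  obtain ⟨k, rfl⟩ := Nat.exists_eq_add_of_le' hn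
  obtain ⟨hF, hL, hLF, hL2⟩ := fib_lucas_bounds k
  have hx := hroot 0
  have hy := hroot 1
  have hz := hroot 2
  obtain ⟨hzx, hxy⟩ := hord
  unfold fpoly at hx hy hz
  have hα := alpha_gt
  have hα8 : (4 : ℝ) ≤ alpha ^ (k + 8) := by
    calc (4 : ℝ) ≤ 1.6 ^ 8 := by norm_num
      _ ≤ alpha ^ 8 := by gcongr
      _ ≤ alpha ^ (k + 8) := pow_le_pow_right₀ (by linarith) (by omega)
  generalize (Nat.fib (k + 10) : ℝ) = A at *
  generalize (lucas (k + 10) : ℝ) = B at *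
  obtain ⟨z0, z1, hAx, hxA, hBy⟩ :=
    root_location_s11 (by linarith) (by linarith) hx hy hz hzx hxy
  have hfac := cubic_eq_prod_of_roots hx hy hz hxy.ne hzx.ne' (hzx.trans hxy).ne'
  have hlog_lower : ∀ m : ℕ, ∀ t : ℝ, alpha ^ m ≤ t → (m : ℝ) * Real.log alpha ≤ Real.log t := by
    intro m t h
    rw [← Real.log_pow]
    exact Real.log_le_log (by positivity) h
  have hlog_upper : ∀ t : ℝ, 0 < t → t ≤ B → Real.log t ≤ ((k + 10 : ℕ) : ℝ) * Real.log 2 := by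
    intro t h0 h
    rw [← Real.log_pow]
    exact Real.log_le_log h0 (h.trans hL2)
  have hu : Real.log |r 2| = -(Real.log (A - r 2) + Real.log (B - r 2)) := by
    rw [Real.log_abs, ← Real.log_mul (by linarith) (by linarith), ← Real.log_inv]
    congr 1
    exact eq_inv_of_mul_eq_one_left (by linear_combination hz)
  have hv : Real.log |r 0 - A| = -(Real.log (r 0) + Real.log (B - r 0)) := by
    rw [abs_sub_comm, Real.log_abs, ← Real.log_mul (by linarith) (by linarith), ← Real.log_inv]
    congr 1
    exact eq_inv_of_mul_eq_one_left (by linear_combination hx)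
  have hb : Real.log |r 2 - A| = Real.log (A - r 2) := by rw [abs_sub_comm, Real.log_abs]
  have ha : Real.log |r 0| = Real.log (r 0) := Real.log_abs _
  have hsum : Real.log |r 1| = -Real.log |r 0| - Real.log |r 2| := by
    have h := congrArg Real.log (show r 0 * r 1 * r 2 = 1 by linear_combination hfac 0)
    rw [Real.log_mul (by nlinarith) z0.ne', Real.log_mul (by linarith) (by linarith),
      Real.log_one] at h
    simp only [Real.log_abs]
    linarith
  have hsum' : Real.log |r 1 - A| = -Real.log |r 0 - A| - Real.log |r 2 - A| := by
    have hne₀ : r 0 - A ≠ 0 := by linarith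
    have hne₁ : r 1 - A ≠ 0 := by linarith
    have hne₂ : r 2 - A ≠ 0 := by linarith
    have h := congrArg Real.log
      (show (r 0 - A) * (r 1 - A) * (r 2 - A) = 1 by linear_combination hfac A)
    rw [Real.log_mul (mul_ne_zero hne₀ hne₁) hne₂, Real.log_mul hne₀ hne₁, Real.log_one] at h
    simp only [Real.log_abs]
    linarith
  have hcast : ((k + 10 : ℕ) : ℝ) = k + 10 := by push_cast; rfl
  have hk : (0 : ℝ) ≤ k := Nat.cast_nonneg k
  have c8 : ((k + 8 : ℕ) : ℝ) = ((k + 10 : ℕ) : ℝ) - 2 := by push_cast; ring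
  have c9 : ((k + 9 : ℕ) : ℝ) = ((k + 10 : ℕ) : ℝ) - 1 := by push_cast; ring
  have key := regulator_form_bounds (N := ((k + 10 : ℕ) : ℝ)) (l := Real.log alpha)
    (s := ((k + 10 : ℕ) : ℝ) * Real.log 2) (a := Real.log (r 0)) (b := Real.log (A - r 2))
    (p := Real.log (B - r 2)) (q := Real.log (B - r 0))
    (by linarith) (Real.log_nonneg (by linarith))
    (by nlinarith [Real.log_two_lt_d9])
    (c8 ▸ hlog_lower _ _ (by linarith)) (c8 ▸ hlog_lower _ _ (by linarith))
    (c9 ▸ hlog_lower _ _ (by linarith)) (c8 ▸ hlog_lower _ _ (by linarith))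
    (hlog_upper _ (by linarith) (by linarith)) (hlog_upper _ (by linarith) (by linarith))
    (hlog_upper _ (by linarith) (by linarith)) (hlog_upper _ (by linarith) (by linarith))
  set D := (Real.log (A - r 2) + Real.log (B - r 2)) * (Real.log (r 0) + Real.log (B - r 0))
    - Real.log (r 0) * Real.log (A - r 2) with hD
  have hD0 : 0 ≤ D := le_trans (by positivity) key.1
  have habs : |Real.log |r i| * Real.log |r i' - A| - Real.log |r i - A| * Real.log (|r i'|)|
      = D := by
    rw [← abs_of_nonneg hD0, abs_eq_abs, hD]
    fin_cases i <;> fin_cases i' <;> first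
      | exact absurd rfl hii'
      | (simp only [Fin.zero_eta, Fin.mk_one, Fin.reduceFinMk, hsum, hsum', ha, hb, hu, hv]
         first
          | (left; ring1)
          | (right; ring1))
  rw [habs]
  exact key
end

section
/- Let n ≥ 10, let (x,y) ∈ ℤ² with |y| ≥ 2 satisfy (x − F_n·y)(x − L_n·y)·x − y³ = ±1, and let j ∈ {1,2,3} be an index at which |x − r_i·y| is minimal. Then for every i ∈ {1,2,3} with i ≠ j one has log|x − r_i·y| ≤ log|y| + n·log α + 1. -/
open Real

theorem lucas_pos_and_fib_le (n : ℕ) : 1 ≤ lucas n ∧ (Nat.fib n : ℤ) ≤ lucas n := by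
  induction n using Nat.twoStepInduction with
  | zero => simp [lucas]
  | one => simp [lucas]
  | more n ih₀ ih₁ =>
    rw [lucas, Nat.fib_add_two]
    push_cast
    omega

theorem alpha_eq_goldenRatio : alpha = goldenRatio := rfl

theorem lucas_eq (n : ℕ) : (lucas n : ℝ) = goldenRatio ^ n + goldenConj ^ n := by
  induction n using Nat.twoStepInduction with
  | zero => norm_num [lucas]
  | one => simp [lucas, goldenRatio_add_goldenConj]
  | more n ih₀ ih₁ =>
    rw [lucas]
    push_cast
    rw [ih₀, ih₁, pow_add _ n 2, pow_add _ n 2, goldenRatio_sq, goldenConj_sq]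
    ring

theorem lucas_add_one_le {n : ℕ} (hn : 2 ≤ n) : (lucas n : ℝ) + 1 ≤ 2 * alpha ^ n := by
  have hψ : goldenConj ^ n ≤ 1 := by
    refine (le_abs_self _).trans ?_
    rw [abs_pow]
    refine pow_le_one₀ (abs_nonneg _) (abs_le.2 ⟨neg_one_lt_goldenConj.le, ?_⟩)
    linarith [goldenConj_neg]
  have hα : goldenRatio ^ 2 ≤ goldenRatio ^ n :=
    pow_le_pow_right₀ one_lt_goldenRatio.le hn
  rw [goldenRatio_sq] at hα
  rw [lucas_eq, alpha_eq_goldenRatio]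
  linarith [one_lt_goldenRatio]

/-- If `(s - F_n) (s - L_n) s` lies in `(0, 2]`, then `s` lies in `(0, L_n + 1]`. -/
theorem pos_and_le_of_cubic_bounds (n : ℕ) {s : ℝ}
    (h₀ : 0 < (s - (Nat.fib n : ℝ)) * (s - (lucas n : ℝ)) * s)
    (h₂ : (s - (Nat.fib n : ℝ)) * (s - (lucas n : ℝ)) * s ≤ 2) :
    0 < s ∧ s ≤ lucas n + 1 := by
  obtain ⟨hL, hFL⟩ := lucas_pos_and_fib_le n
  have hL' : (1 : ℝ) ≤ lucas n := by exact_mod_cast hL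
  have hFL' : (Nat.fib n : ℝ) ≤ lucas n := by exact_mod_cast hFL
  have hF : (0 : ℝ) ≤ Nat.fib n := Nat.cast_nonneg _
  constructor
  · by_contra! hs
    have := mul_nonneg_of_nonpos_of_nonpos (a := s - (Nat.fib n : ℝ))
      (b := s - (lucas n : ℝ)) (by linarith) (by linarith)
    linarith [mul_nonpos_of_nonneg_of_nonpos this hs]
  · by_contra! hs
    have : 1 ≤ (s - (Nat.fib n : ℝ)) * (s - (lucas n : ℝ)) :=
      one_le_mul_of_one_le_of_one_le (by linarith) (by linarith)
    nlinarith

theorem log_beta_upper_bound (n : ℕ) (hn : 10 ≤ n) (x y : ℤ) (hy : 2 ≤ |y|)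
    (heq : (x - (Nat.fib n : ℤ) * y) * (x - lucas n * y) * x - y ^ 3 = 1 ∨
      (x - (Nat.fib n : ℤ) * y) * (x - lucas n * y) * x - y ^ 3 = -1)
    (r : Fin 3 → ℝ)
    (hroot : ∀ i, fpoly n (r i) = 0)
    (hord : r 2 < r 0 ∧ r 0 < r 1)
    (j : Fin 3)
    (hmin : ∀ i, |(x : ℝ) - r j * (y : ℝ)| ≤ |(x : ℝ) - r i * (y : ℝ)|) :
    ∀ i, i ≠ j → Real.log |(x : ℝ) - r i * (y : ℝ)|
      ≤ Real.log |(y : ℝ)| + (n : ℝ) * Real.log alpha + 1 := by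
  intro i _
  have hy2 : (2 : ℝ) ≤ |(y : ℝ)| := by exact_mod_cast hy
  have hy0 : (y : ℝ) ≠ 0 := abs_pos.1 (by linarith)
  obtain ⟨hr0, hrL⟩ : 0 < r i ∧ r i ≤ lucas n + 1 := by
    have h := hroot i
    unfold fpoly at h
    exact pos_and_le_of_cubic_bounds n (by linarith) (by linarith)
  obtain ⟨ht0, htL⟩ : 0 < (x : ℝ) / y ∧ (x : ℝ) / y ≤ lucas n + 1 := by
    have hinv : |((y : ℝ) ^ 3)⁻¹| < 1 := by
      rw [abs_inv, abs_pow]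
      exact inv_lt_one_of_one_lt₀ (one_lt_pow₀ (by linarith) (by norm_num))
    obtain ⟨hl, hu⟩ := abs_lt.1 hinv
    have hdiv : ((x : ℝ) / y - (Nat.fib n : ℝ)) * ((x : ℝ) / y - (lucas n : ℝ)) * ((x : ℝ) / y)
        = ((x - (Nat.fib n : ℝ) * y) * (x - lucas n * y) * x) * ((y : ℝ) ^ 3)⁻¹ := by
      field_simp
    have hy3 : (y : ℝ) ^ 3 * ((y : ℝ) ^ 3)⁻¹ = 1 := mul_inv_cancel₀ (pow_ne_zero 3 hy0)
    rcases heq with h | h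
    · have h' : (x - (Nat.fib n : ℝ) * y) * (x - lucas n * y) * x = (y : ℝ) ^ 3 + 1 := by
        have : (x - (Nat.fib n : ℝ) * y) * (x - lucas n * y) * x - (y : ℝ) ^ 3 = 1 := by
          exact_mod_cast h
        linarith
      rw [h', add_mul, hy3] at hdiv
      exact pos_and_le_of_cubic_bounds n (by linarith) (by linarith)
    · have h' : (x - (Nat.fib n : ℝ) * y) * (x - lucas n * y) * x = (y : ℝ) ^ 3 + -1 := by
        have : (x - (Nat.fib n : ℝ) * y) * (x - lucas n * y) * x - (y : ℝ) ^ 3 = -1 := by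
          exact_mod_cast h
        linarith
      rw [h', add_mul, hy3] at hdiv
      exact pos_and_le_of_cubic_bounds n (by linarith) (by linarith)
  have hα : 1 < alpha := one_lt_goldenRatio
  have hαn : 0 < alpha ^ n := by positivity
  have hL := lucas_add_one_le (n := n) (by omega)
  have he : 2 ≤ Real.exp 1 := by linarith [Real.add_one_le_exp (1 : ℝ)]
  have hbound : |(x : ℝ) - r i * y| ≤ |(y : ℝ)| * alpha ^ n * Real.exp 1 := by
    have hfac : (x : ℝ) - r i * y = y * ((x : ℝ) / y - r i) := by
      field_simp
    rw [hfac, abs_mul, mul_assoc]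
    refine mul_le_mul_of_nonneg_left ?_ (abs_nonneg _)
    rw [abs_le]
    constructor <;> nlinarith
  have hrhs : Real.log |(y : ℝ)| + (n : ℝ) * Real.log alpha + 1
      = Real.log (|(y : ℝ)| * alpha ^ n * Real.exp 1) := by
    rw [Real.log_mul (by positivity) (by positivity), Real.log_mul (by positivity) (by positivity),
      Real.log_pow, Real.log_exp]
  rcases (abs_nonneg ((x : ℝ) - r i * y)).eq_or_lt with h0 | hpos
  · rw [← h0, Real.log_zero]
    have := Real.log_nonneg (x := |(y : ℝ)|) (by linarith)
    have := Real.log_nonneg hα.le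
    positivity
  · rw [hrhs]
    exact Real.log_le_log hpos hbound
end
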